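/- Let f : [0,1] → [0,1] be a continuous topologically transitive map. Then the hyperspace of ω-limit sets ω(f) is a totally disconnected subspace of 2^{[0,1]}. -/

import Mathlib

open TopologicalSpace Filter Topology

/-- The ω-limit set of a point `x` under a map `f`:
`ω(x,f) = ⋂ₙ cl { f^k(x) : k ≥ n }`. -/
def omegaLimitSet {X : Type*} [TopologicalSpace X] (f : X → X) (x : X) : Set X :=
  ⋂ n : ℕ, closure {y | ∃ k ≥ n, f^[k] x = y}

/-- The hyperspace of ω-limit sets of `f`, as a subset of the hyperspace `2^X`. -/
def omegaHyperspace {X : Type*} [MetricSpace X] (f : X → X) :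
    Set (NonemptyCompacts X) :=
  {A | ∃ x : X, (A : Set X) = omegaLimitSet f x}

/-- A map `f` is topologically transitive if for all nonempty open `U, V` there is
`n ∈ ℕ` (a positive integer) with `f^[n](U) ∩ V ≠ ∅`. -/
def TopTransitive {X : Type*} [TopologicalSpace X] (f : X → X) : Prop :=
  ∀ U V : Set X, IsOpen U → IsOpen V → U.Nonempty → V.Nonempty →
    ∃ n : ℕ, 0 < n ∧ ((f^[n] '' U) ∩ V).Nonempty

/-- ω-limit sets of a continuous map are forward invariant. -/
theorem mapsTo_omegaLimitSet {X : Type*} [TopologicalSpace X] {f : X → X} (hf : Continuous f)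
    (x : X) : Set.MapsTo f (omegaLimitSet f x) (omegaLimitSet f x) := by
  intro y hy
  refine Set.mem_iInter.2 fun n => ?_
  refine map_mem_closure hf (Set.mem_iInter.1 hy n) ?_
  rintro _ ⟨k, hk, rfl⟩
  exact ⟨k + 1, by omega, Function.iterate_succ_apply' f k x⟩

/-- A closed forward invariant set containing a point whose orbit meets every nonempty member of
a topological basis is the whole space. -/
theorem eq_univ_of_mapsTo_of_orbit_meets_basis {X : Type*} [TopologicalSpace X] {f : X → X}
    {b : Set (Set X)} (hb : IsTopologicalBasis b) {E : Set X} (hE : IsClosed E)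
    (hfE : Set.MapsTo f E E) {x : X} (hx : x ∈ E)
    (horb : ∀ V ∈ b, V.Nonempty → ∃ n : ℕ, f^[n] x ∈ V) : E = Set.univ := by
  have hd : Dense E := by
    refine hb.dense_iff.2 fun V hV hne => ?_
    obtain ⟨n, hn⟩ := horb V hV hne
    exact ⟨_, hn, hfE.iterate n hx⟩
  rw [← hE.closure_eq, hd.closure_eq]

/-- The points of a transitive system that visit a given nonempty open set form a dense set. -/
theorem TopTransitive.dense_iUnion_preimage {X : Type*} [TopologicalSpace X] {f : X → X}
    (h : TopTransitive f) {V : Set X} (hV : IsOpen V) (hne : V.Nonempty) :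
    Dense (⋃ n : ℕ, f^[n] ⁻¹' V) := by
  refine dense_iff_inter_open.2 fun U hU hUne => ?_
  obtain ⟨n, -, _, ⟨x, hxU, rfl⟩, hxV⟩ := h U V hU hV hUne hne
  exact ⟨x, hxU, Set.mem_iUnion.2 ⟨n, hxV⟩⟩

/-- Removing from the line the complement of a dense subset of a subspace leaves a dense set. -/
theorem Dense.compl_image_val_compl {X : Type*} [TopologicalSpace X] {s : Set X} {U : Set s}
    (hU : Dense U) : Dense (((↑) : s → X) '' Uᶜ)ᶜ := by
  rw [← interior_eq_empty_iff_dense_compl, Set.eq_empty_iff_forall_notMem]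
  intro t ht
  obtain ⟨u, -, rfl⟩ := interior_subset ht
  obtain ⟨v, hv, hvU⟩ := hU.inter_open_nonempty _
    (isOpen_interior.preimage continuous_subtype_val) ⟨u, ht⟩
  obtain ⟨w, hw, hwv⟩ := interior_subset hv
  exact hw (Subtype.ext hwv ▸ hvU)

/-- Given countably many dense open subsets `W i` of the line, arbitrarily small distances `r`
have both `z + r` and `z - r` in every `W i`. -/
theorem exists_mem_Ioo_add_sub_mem {ι : Type*} [Countable ι] {W : ι → Set ℝ}
    (hWo : ∀ i, IsOpen (W i)) (hWd : ∀ i, Dense (W i)) (z : ℝ) {δ : ℝ} (hδ : 0 < δ) :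
    ∃ r ∈ Set.Ioo 0 δ, ∀ i, z + r ∈ W i ∧ z - r ∈ W i := by
  have hd : Dense (⋂ i, ((fun r => z + r) ⁻¹' W i ∩ (fun r => z - r) ⁻¹' W i)) := by
    refine dense_iInter_of_isOpen (fun i => ?_) fun i => ?_
    · exact ((hWo i).preimage (by fun_prop)).inter ((hWo i).preimage (by fun_prop))
    · exact ((hWd i).preimage (Homeomorph.addLeft z).isOpenMap).inter_of_isOpen_left
        ((hWd i).preimage (Homeomorph.subLeft z).isOpenMap) ((hWo i).preimage (by fun_prop))
  obtain ⟨r, hr, hrW⟩ := hd.inter_open_nonempty _ isOpen_Ioo (Set.nonempty_Ioo.2 hδ)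
  exact ⟨r, hr, fun i => Set.mem_iInter.1 hrW i⟩

/-- For a transitive interval map and any point `z`, there are arbitrarily small `r > 0` such that
no ω-limit set lies at distance exactly `r` from `z`. -/
theorem exists_mem_Ioo_infDist_ne {f : unitInterval → unitInterval} (hf : Continuous f)
    (htrans : TopTransitive f) (z : unitInterval) {δ : ℝ} (hδ : 0 < δ) :
    ∃ r ∈ Set.Ioo 0 δ, ∀ E ∈ omegaHyperspace f, Metric.infDist z (E : Set unitInterval) ≠ r := by
  obtain ⟨b, hbc, hbe, hb⟩ := exists_countable_basis unitInterval
  have : Countable b := hbc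
  have hne (V : b) : (V : Set unitInterval).Nonempty :=
    Set.nonempty_iff_ne_empty.2 fun h => hbe (h ▸ V.2)
  have hUo (V : b) : IsOpen (⋃ n : ℕ, f^[n] ⁻¹' (V : Set unitInterval)) :=
    isOpen_iUnion fun n => (hb.isOpen V.2).preimage (hf.iterate n)
  obtain ⟨r, hr, hrW⟩ := exists_mem_Ioo_add_sub_mem
    (W := fun V : b => (((↑) : unitInterval → ℝ) '' (⋃ n : ℕ, f^[n] ⁻¹' (V : Set unitInterval))ᶜ)ᶜ)
    (fun V => ((hUo V).isClosed_compl.isCompact.image continuous_subtype_val).isClosed.isOpen_compl)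
    (fun V => (htrans.dense_iUnion_preimage (hb.isOpen V.2) (hne V)).compl_image_val_compl)
    (z : ℝ) hδ
  refine ⟨r, hr, ?_⟩
  rintro E ⟨x, hx⟩ hdist
  obtain ⟨y, hyE, hy⟩ := E.isCompact.exists_infDist_eq_dist E.nonempty z
  rw [hdist, Subtype.dist_eq, Real.dist_eq] at hy
  have hyz : (y : ℝ) = z + r ∨ (y : ℝ) = z - r := by
    rcases abs_choice ((z : ℝ) - y) with h | h
    · right; linarith
    · left; linarith
  have hE : (E : Set unitInterval) = Set.univ := by
    refine eq_univ_of_mapsTo_of_orbit_meets_basis hb E.isCompact.isClosed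
      (hx ▸ mapsTo_omegaLimitSet hf x) hyE fun V hV _ => ?_
    have hyW : (y : ℝ) ∉
        ((↑) : unitInterval → ℝ) '' (⋃ n : ℕ, f^[n] ⁻¹' (V : Set unitInterval))ᶜ := by
      rcases hyz with h | h
      · exact h ▸ (hrW ⟨V, hV⟩).1
      · exact h ▸ (hrW ⟨V, hV⟩).2
    by_contra hV
    exact hyW ⟨y, fun h => hV (Set.mem_iUnion.1 h), rfl⟩
  rw [Metric.infDist_zero_of_mem (hE ▸ Set.mem_univ z)] at hdist
  exact hr.1.ne hdist

/-- If `f : [0,1] → [0,1]` is a continuous topologically transitive map, then the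
hyperspace of ω-limit sets `ω(f)` is a totally disconnected subspace of `2^[0,1]`. -/
theorem omegaHyperspace_totallyDisconnected_unitInterval
    (f : unitInterval → unitInterval) (hf : Continuous f) (htrans : TopTransitive f) :
    IsTotallyDisconnected (omegaHyperspace f) := by
  intro C hC hCp
  have hsub : ∀ A ∈ C, ∀ B ∈ C, (A : Set unitInterval) ⊆ B := by
    intro A hA B hB z hzA
    by_contra hzB
    have hδ := (B.isCompact.isClosed.notMem_iff_infDist_pos B.nonempty).1 hzB
    obtain ⟨r, hr, hrE⟩ := exists_mem_Ioo_infDist_ne hf htrans z hδ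
    obtain ⟨E, hE, hEr⟩ := hCp.intermediate_value hA hB
      (Metric.lipschitz_infDist_set z).continuous.continuousOn
      ⟨(Metric.infDist_zero_of_mem hzA).trans_le hr.1.le, hr.2.le⟩
    exact hrE E (hC hE) hEr
  exact fun A hA B hB => SetLike.coe_injective ((hsub A hA B hB).antisymm (hsub B hB A hA))
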